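/- Let U ⊆ ℝ^m be open, let g : U → Matrix (Fin m) (Fin m) ℝ be smooth with g(x) symmetric and invertible for every x, let g^{ab} denote the entries of g(x)⁻¹, s := √|det g|, and let Γ^c_{ab} := ½ g^{cd}(∂_a g_{bd} + ∂_b g_{ad} − ∂_d g_{ab}) be the Levi-Civita Christoffel symbols. Let κ^i_{aj} : U → ℂ and μ ∈ ℝ, and let φ^i, φ̄_i : U → ℂ be smooth. Put ∇_a φ^i := ∂_a φ^i − κ^i_{aj} φ^j, ∇_a φ̄_i := ∂_a φ̄_i + κ^j_{ai} φ̄_j, ℓ := ½ (g^{ab} ∇_a φ̄_i ∇_b φ^i − μ² φ̄_i φ^i) s, U^a_b := ℓ δ^a_b − ½ g^{ac} (∇_c φ̄_i ∇_b φ^i + ∇_b φ̄_i ∇_c φ^i) s, Ŭ^a_b := U^a_b / s, and ρ_{ab}{}^i{}_j := ∂_b κ^i_{aj} − ∂_a κ^i_{bj} + κ^i_{ah} κ^h_{bj} − κ^i_{bh} κ^h_{aj}. Assume the field equations ∂_a (g^{ab} s ∇_b φ^i) − g^{ab} s κ^i_{aj} ∇_b φ^j + μ² s φ^i = 0 and ∂_a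 (g^{ab} s ∇_b φ̄_i) + g^{ab} s κ^j_{ai} ∇_b φ̄_j + μ² s φ̄_i = 0 hold on U. Then the covariant divergence ∇_a Ŭ^a_b := ∂_a Ŭ^a_b + Γ^a_{ac} Ŭ^c_b − Γ^c_{ab} Ŭ^a_c equals ½ g^{ac} ρ_{ab}{}^i{}_j (φ̄_i ∇_c φ^j − ∇_c φ̄_i φ^j) on U. -/

import Mathlib

open Matrix

noncomputable section

/-- Partial derivative `∂_a f (x)` in the `a`-th coordinate direction of `ℝ^m`
(for real- or complex-valued `f`). -/
def pd {m : ℕ} {E : Type*} [NormedAddCommGroup E] [NormedSpace ℝ E]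
    (f : (Fin m → ℝ) → E) (a : Fin m) (x : Fin m → ℝ) : E :=
  fderiv ℝ f x (Pi.single a 1)

section PartialDerivatives

variable {m : ℕ} {x : Fin m → ℝ}

lemma pd_congr {E : Type*} [NormedAddCommGroup E] [NormedSpace ℝ E]
    {f h : (Fin m → ℝ) → E} (hfh : f =ᶠ[nhds x] h) (a : Fin m) : pd f a x = pd h a x := by
  rw [pd, pd, hfh.fderiv_eq]

lemma pd_const {E : Type*} [NormedAddCommGroup E] [NormedSpace ℝ E] (c : E) (a : Fin m) :
    pd (fun _ : Fin m → ℝ => c) a x = 0 := by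
  simp [pd]

lemma pd_add {E : Type*} [NormedAddCommGroup E] [NormedSpace ℝ E] {f h : (Fin m → ℝ) → E}
    (hf : DifferentiableAt ℝ f x) (hh : DifferentiableAt ℝ h x) (a : Fin m) :
    pd (fun t => f t + h t) a x = pd f a x + pd h a x := by
  simp [pd, fderiv_fun_add hf hh]

lemma pd_sub {E : Type*} [NormedAddCommGroup E] [NormedSpace ℝ E] {f h : (Fin m → ℝ) → E}
    (hf : DifferentiableAt ℝ f x) (hh : DifferentiableAt ℝ h x) (a : Fin m) :
    pd (fun t => f t - h t) a x = pd f a x - pd h a x := by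
  simp [pd, fderiv_fun_sub hf hh]

lemma pd_sum {E ι : Type*} [NormedAddCommGroup E] [NormedSpace ℝ E] {u : Finset ι}
    {f : ι → (Fin m → ℝ) → E} (hf : ∀ i ∈ u, DifferentiableAt ℝ (f i) x) (a : Fin m) :
    pd (fun t => ∑ i ∈ u, f i t) a x = ∑ i ∈ u, pd (f i) a x := by
  simp [pd, fderiv_fun_sum hf]

lemma pd_mul {A : Type*} [NormedCommRing A] [NormedAlgebra ℝ A] {f h : (Fin m → ℝ) → A}
    (hf : DifferentiableAt ℝ f x) (hh : DifferentiableAt ℝ h x) (a : Fin m) :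
    pd (fun t => f t * h t) a x = pd f a x * h x + f x * pd h a x := by
  simp only [pd, fderiv_fun_mul hf hh, _root_.add_apply,
    _root_.smul_apply, smul_eq_mul]
  ring

lemma pd_const_mul {A : Type*} [NormedCommRing A] [NormedAlgebra ℝ A] {f : (Fin m → ℝ) → A}
    (c : A) (hf : DifferentiableAt ℝ f x) (a : Fin m) :
    pd (fun t => c * f t) a x = c * pd f a x := by
  rw [pd_mul (differentiableAt_const c) hf, pd_const, zero_mul, zero_add]

lemma pd_ofReal {f : (Fin m → ℝ) → ℝ} (hf : DifferentiableAt ℝ f x) (a : Fin m) :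
    pd (fun t => (f t : ℂ)) a x = ((pd f a x : ℝ) : ℂ) := by
  have h := Complex.ofRealCLM.hasFDerivAt.comp x hf.hasFDerivAt
  have h' : HasFDerivAt (fun t => (f t : ℂ)) (Complex.ofRealCLM.comp (fderiv ℝ f x)) x := h
  simp [pd, h'.fderiv]

lemma differentiableAt_ofReal {f : (Fin m → ℝ) → ℝ} (hf : DifferentiableAt ℝ f x) :
    DifferentiableAt ℝ (fun t => (f t : ℂ)) x :=
  Complex.ofRealCLM.differentiableAt.comp x hf

lemma differentiableAt_pd {E : Type*} [NormedAddCommGroup E] [NormedSpace ℝ E]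
    {f : (Fin m → ℝ) → E} (hf : ContDiffAt ℝ (⊤ : ℕ∞) f x) (a : Fin m) :
    DifferentiableAt ℝ (fun t => pd f a t) x := by
  have h : ContDiffAt ℝ 1 (fderiv ℝ f) x := hf.fderiv_right (by norm_cast)
  exact (h.differentiableAt (by simp)).clm_apply (differentiableAt_const _)

lemma pd_pd_apply {E : Type*} [NormedAddCommGroup E] [NormedSpace ℝ E]
    {f : (Fin m → ℝ) → E} (hf : ContDiffAt ℝ (⊤ : ℕ∞) f x) (a b : Fin m) :
    pd (fun t => pd f a t) b x
      = fderiv ℝ (fderiv ℝ f) x (Pi.single b 1) (Pi.single a 1) := by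
  have h : ContDiffAt ℝ 1 (fderiv ℝ f) x := hf.fderiv_right (by norm_cast)
  have h' := (h.differentiableAt (by simp)).hasFDerivAt.clm_apply
    (hasFDerivAt_const (Pi.single a (1 : ℝ)) x)
  have h'' : HasFDerivAt (fun t => pd f a t) _ x := h'
  rw [pd, h''.fderiv]
  simp

lemma pd_comm {E : Type*} [NormedAddCommGroup E] [NormedSpace ℝ E]
    {f : (Fin m → ℝ) → E} (hf : ContDiffAt ℝ (⊤ : ℕ∞) f x) (a b : Fin m) :
    pd (fun t => pd f a t) b x = pd (fun t => pd f b t) a x := by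
  rw [pd_pd_apply hf, pd_pd_apply hf]
  exact hf.isSymmSndFDerivAt (by simpa using (by norm_cast : (2 : WithTop ℕ∞) ≤ (⊤ : ℕ∞))) _ _

end PartialDerivatives

section Metric

variable {m : ℕ} {k : ℕ} {x : Fin m → ℝ} {g : (Fin m → ℝ) → Matrix (Fin k) (Fin k) ℝ}

/-- Jacobi's formula for the derivative of a determinant. -/
lemma hasFDerivAt_det (hg : ∀ a b, DifferentiableAt ℝ (fun t => g t a b) x) :
    HasFDerivAt (fun t => (g t).det)
      (∑ a, ∑ b, (g x).adjugate b a • fderiv ℝ (fun t => g t a b) x) x := by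
  let D : ContinuousMultilinearMap ℝ (fun _ : Fin k => Fin k → ℝ) ℝ :=
    ⟨(Matrix.detRowAlternating (n := Fin k) (R := ℝ)).toMultilinearMap,
      Continuous.matrix_det continuous_id⟩
  have hrow : HasFDerivAt (fun t => (g t : Fin k → Fin k → ℝ))
      (ContinuousLinearMap.pi fun a => ContinuousLinearMap.pi fun b =>
        fderiv ℝ (fun t => g t a b) x) x :=
    hasFDerivAt_pi.2 fun a => hasFDerivAt_pi.2 fun b => (hg a b).hasFDerivAt
  have h := (D.hasFDerivAt (x := (g x : Fin k → Fin k → ℝ))).comp x hrow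
  refine HasFDerivAt.congr_fderiv (h : HasFDerivAt (fun t => (g t).det) _ x) ?_
  ext v
  have hdet : ∀ (a : Fin k) (w : Fin k → ℝ),
      D (Function.update (g x : Fin k → Fin k → ℝ) a w) = ∑ b, (g x).adjugate b a * w b := by
    intro a w
    change ((g x).updateRow a w).det = _
    rw [← Matrix.cramer_transpose_apply, Matrix.cramer_eq_adjugate_mulVec,
      ← Matrix.adjugate_transpose]
    simp [Matrix.mulVec, dotProduct]
  refine (D.linearDeriv_apply _ _).trans ((Finset.sum_congr rfl fun a _ => hdet a _).trans ?_)
  simp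

lemma differentiableAt_det (hg : ∀ a b, DifferentiableAt ℝ (fun t => g t a b) x) :
    DifferentiableAt ℝ (fun t => (g t).det) x :=
  (hasFDerivAt_det hg).differentiableAt

lemma differentiableAt_inv_apply (hg : ∀ a b, DifferentiableAt ℝ (fun t => g t a b) x)
    (hdet : (g x).det ≠ 0) (a b : Fin k) : DifferentiableAt ℝ (fun t => (g t)⁻¹ a b) x := by
  have hadj : DifferentiableAt ℝ (fun t => (g t).adjugate a b) x := by
    simp only [Matrix.adjugate_apply]
    refine differentiableAt_det fun c d => ?_
    by_cases hc : c = b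
    · simp [hc]
    · simpa [Matrix.updateRow_ne hc] using hg c d
  simpa [Matrix.inv_def] using ((differentiableAt_det hg).fun_inv hdet).fun_mul hadj

/-- The derivative of the volume density `√|det g|`. -/
lemma pd_sqrt_abs_det (hg : ∀ a b, DifferentiableAt ℝ (fun t => g t a b) x)
    (hdet : (g x).det ≠ 0) (c : Fin m) :
    DifferentiableAt ℝ (fun t => Real.sqrt |(g t).det|) x ∧
    pd (fun t => Real.sqrt |(g t).det|) c x = Real.sqrt |(g x).det| *
      ((1 / 2) * ∑ a, ∑ b, (g x)⁻¹ b a * pd (fun t => g t a b) c x) := by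
  have habs := (hasDerivAt_abs hdet).comp_hasFDerivAt x (hasFDerivAt_det hg)
  have h := habs.sqrt (by simpa using hdet)
  have h' : HasFDerivAt (fun t => Real.sqrt |(g t).det|) _ x := h
  refine ⟨h'.differentiableAt, ?_⟩
  rw [pd, h'.fderiv]
  have hs : Real.sqrt |(g x).det| ≠ 0 := (Real.sqrt_pos.2 (abs_pos.2 hdet)).ne'
  have hsq : Real.sqrt |(g x).det| * Real.sqrt |(g x).det| = |(g x).det| :=
    Real.mul_self_sqrt (abs_nonneg _)
  have hadj : ∀ a b, (g x).adjugate b a = (g x).det * (g x)⁻¹ b a := by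
    intro a b
    simp [Matrix.inv_def, hdet]
  have hsum : ∑ a, ∑ b, (g x).adjugate b a * pd (fun t => g t a b) c x
      = (g x).det * ∑ a, ∑ b, (g x)⁻¹ b a * pd (fun t => g t a b) c x := by
    simp only [hadj, Finset.mul_sum, mul_assoc]
  simp only [_root_.smul_apply, _root_.sum_apply, smul_eq_mul,
    Function.comp_apply]
  change _ * (_ * ∑ a, ∑ b, (g x).adjugate b a * pd (fun t => g t a b) c x) = _
  rw [hsum]
  have hsgn : ((SignType.sign (g x).det : SignType) : ℝ) * (g x).det = |(g x).det| :=
    sign_mul_self _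
  field_simp
  rw [sq, hsq, ← hsgn]

/-- The derivative of the inverse matrix, `∂ g⁻¹ = - g⁻¹ (∂ g) g⁻¹`. -/
lemma pd_inv_apply (hg : ∀ a b, DifferentiableAt ℝ (fun t => g t a b) x)
    (hdet : ∀ᶠ t in nhds x, (g t).det ≠ 0) (c : Fin m) (a b : Fin k) :
    pd (fun t => (g t)⁻¹ a b) c x
      = - ∑ d, ∑ e, (g x)⁻¹ a d * pd (fun t => g t d e) c x * (g x)⁻¹ e b := by
  have hx := hdet.self_of_nhds
  have hi := differentiableAt_inv_apply hg hx
  let J : Matrix (Fin k) (Fin k) ℝ := fun a b => pd (fun t => (g t)⁻¹ a b) c x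
  let H : Matrix (Fin k) (Fin k) ℝ := fun a b => pd (fun t => g t a b) c x
  have hJ : J * g x + (g x)⁻¹ * H = 0 := by
    ext a b
    have hone : (fun t => ∑ d, (g t)⁻¹ a d * g t d b)
        =ᶠ[nhds x] fun _ => (1 : Matrix (Fin k) (Fin k) ℝ) a b := by
      filter_upwards [hdet] with t ht
      rw [← Matrix.nonsing_inv_mul (g t) (isUnit_iff_ne_zero.2 ht), Matrix.mul_apply]
    have h := pd_congr hone c
    rw [pd_const, pd_sum fun d _ => (hi a d).fun_mul (hg d b)] at h
    simp only [pd_mul (hi a _) (hg _ b), Finset.sum_add_distrib] at h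
    simpa [Matrix.mul_apply] using h
  have hJ' : J = - ((g x)⁻¹ * H * (g x)⁻¹) := by
    rw [← Matrix.mul_nonsing_inv_cancel_right (A := g x) J (isUnit_iff_ne_zero.2 hx),
      eq_neg_of_add_eq_zero_left hJ, Matrix.neg_mul]
  have h := congrFun (congrFun hJ' a) b
  change J a b = _
  rw [h]
  simp only [Matrix.neg_apply, Matrix.mul_apply, Finset.sum_mul]
  rw [Finset.sum_comm]

end Metric

section Algebra

variable {m n : ℕ}

lemma sum_christoffel_diag {G : Fin m → Fin m → ℝ} (hG : ∀ a b, G a b = G b a)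
    {H : Fin m → Fin m → Fin m → ℝ} (hH : ∀ a b c, H a b c = H a c b) (c : Fin m) :
    ∑ a, (1 / 2) * ∑ d, G a d * (H a c d + H c a d - H d a c)
      = (1 / 2) * ∑ a, ∑ d, G d a * H c a d := by
  have h : ∑ a, ∑ d, G a d * H d a c = ∑ a, ∑ d, G a d * H a c d := by
    rw [Finset.sum_comm]
    exact Finset.sum_congr rfl fun a _ => Finset.sum_congr rfl fun d _ => by rw [hG, hH]
  simp only [← Finset.mul_sum, mul_add, mul_sub, Finset.sum_add_distrib, Finset.sum_sub_distrib,
    h, fun a d => hG d a]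
  ring

lemma christoffel_metric_compatible {G : Fin m → Fin m → ℝ} (hG : ∀ a b, G a b = G b a)
    {H : Fin m → Fin m → Fin m → ℝ} (hH : ∀ a b c, H a b c = H a c b) (b c d : Fin m) :
    ∑ a, (((1 / 2) * ∑ e, G c e * (H a b e + H b a e - H e a b)) * G a d
        + ((1 / 2) * ∑ e, G d e * (H a b e + H b a e - H e a b)) * G a c)
      = ∑ a, ∑ e, G c a * H b a e * G e d := by
  have h : ∑ a, ((1 / 2) * ∑ e, G d e * (H a b e + H b a e - H e a b)) * G a c
      = ∑ a, ∑ e, (1 / 2) * (G c e * (H e a b + H b a e - H a b e) * G a d) := by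
    simp only [Finset.mul_sum, Finset.sum_mul]
    rw [Finset.sum_comm]
    refine Finset.sum_congr rfl fun a _ => Finset.sum_congr rfl fun e _ => ?_
    rw [hG d a, hG e c, hH e b a, hH b e a, hH a e b]
    ring
  rw [Finset.sum_add_distrib, h]
  simp only [Finset.mul_sum, Finset.sum_mul]
  rw [← Finset.sum_add_distrib, Finset.sum_comm (f := fun a e => G c a * H b a e * G e d)]
  refine Finset.sum_congr rfl fun a _ => ?_
  rw [← Finset.sum_add_distrib]
  refine Finset.sum_congr rfl fun e _ => ?_
  rw [hH b a e]
  ring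

/-- The commutator of covariant derivatives of the field, in terms of the curvature. -/
lemma curl_covariantDeriv {K : Fin m → Matrix (Fin n) (Fin n) ℂ}
    {dK : Fin m → Fin m → Matrix (Fin n) (Fin n) ℂ} {φ : Fin n → ℂ} {dφ P : Fin m → Fin n → ℂ}
    {ddφ dP : Fin m → Fin m → Fin n → ℂ} (hsym : ∀ a b, ddφ a b = ddφ b a)
    (hP : ∀ a, P a = dφ a - K a *ᵥ φ)
    (hdP : ∀ a b, dP b a = ddφ b a - (dK b a *ᵥ φ + K a *ᵥ dφ b)) (a b : Fin m) :
    dP b a = dP a b - (dK b a - dK a b + K a * K b - K b * K a) *ᵥ φ - K a *ᵥ P b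
      + K b *ᵥ P a := by
  simp only [hdP, hP, hsym b a, Matrix.add_mulVec, Matrix.sub_mulVec, Matrix.mulVec_sub,
    ← Matrix.mulVec_mulVec]
  abel

/-- The commutator of covariant derivatives of the conjugate field, in terms of the curvature. -/
lemma curl_covariantDeriv_conj {K : Fin m → Matrix (Fin n) (Fin n) ℂ}
    {dK : Fin m → Fin m → Matrix (Fin n) (Fin n) ℂ} {φb : Fin n → ℂ} {dφb Q : Fin m → Fin n → ℂ}
    {ddφb dQ : Fin m → Fin m → Fin n → ℂ} (hsym : ∀ a b, ddφb a b = ddφb b a)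
    (hQ : ∀ a, Q a = dφb a + φb ᵥ* K a)
    (hdQ : ∀ a b, dQ b a = ddφb b a + (φb ᵥ* dK b a + dφb b ᵥ* K a)) (a b : Fin m) :
    dQ b a = dQ a b + φb ᵥ* (dK b a - dK a b + K a * K b - K b * K a) + Q b ᵥ* K a
      - Q a ᵥ* K b := by
  simp only [hdQ, hQ, hsym b a, Matrix.vecMul_add, Matrix.vecMul_sub, Matrix.add_vecMul,
    ← Matrix.vecMul_vecMul]
  abel

/-- The divergence identity at a point: `G` is the inverse metric, `P` and `Q` are the covariant
derivatives of the field and of its conjugate, and a `d` in front of a name stands for the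
partial derivatives. -/
lemma divergence_identity {G : Fin m → Fin m → ℂ} (hG : ∀ a c, G a c = G c a)
    {dG Γ : Fin m → Fin m → Fin m → ℂ}
    (hmet : ∀ b c d, dG b c d = - ∑ a, (Γ c a b * G a d + Γ d a b * G a c))
    {q : ℂ} {φ φb : Fin n → ℂ} {dφ dφb P Q : Fin m → Fin n → ℂ}
    {K : Fin m → Matrix (Fin n) (Fin n) ℂ} {R : Fin m → Fin m → Matrix (Fin n) (Fin n) ℂ}
    {dP dQ : Fin m → Fin m → Fin n → ℂ}
    (hP : ∀ a, P a = dφ a - K a *ᵥ φ) (hQ : ∀ a, Q a = dφb a + φb ᵥ* K a)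
    (hdP : ∀ a b, dP b a = dP a b - R a b *ᵥ φ - K a *ᵥ P b + K b *ᵥ P a)
    (hdQ : ∀ a b, dQ b a = dQ a b + φb ᵥ* R a b + Q b ᵥ* K a - Q a ᵥ* K b)
    (b : Fin m)
    (hE : (∑ a, ∑ c, ((dG a a c + G a c * ∑ d, Γ d d a) * (Q b ⬝ᵥ P c)
      + G a c * (Q b ⬝ᵥ dP a c) - G a c * (Q b ⬝ᵥ K a *ᵥ P c))) + q * (Q b ⬝ᵥ φ) = 0)
    (hEb : (∑ a, ∑ c, ((dG a a c + G a c * ∑ d, Γ d d a) * (Q c ⬝ᵥ P b)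
      + G a c * (dQ a c ⬝ᵥ P b) + G a c * (Q c ⬝ᵥ K a *ᵥ P b))) + q * (φb ⬝ᵥ P b) = 0)
    {L : ℂ} {V : Fin m → Fin m → ℂ}
    (hV : ∀ a b, V a b = L * (if a = b then 1 else 0)
      - (1 / 2) * ∑ c, G a c * (Q c ⬝ᵥ P b + Q b ⬝ᵥ P c)) :
    ((1 / 2) * ((∑ a, ∑ c, (dG b a c * (Q a ⬝ᵥ P c)
          + G a c * (dQ b a ⬝ᵥ P c + Q a ⬝ᵥ dP b c)))
        - q * (dφb b ⬝ᵥ φ + φb ⬝ᵥ dφ b))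
      - (1 / 2) * ∑ a, ∑ c, (dG a a c * (Q c ⬝ᵥ P b + Q b ⬝ᵥ P c)
          + G a c * (dQ a c ⬝ᵥ P b + Q c ⬝ᵥ dP a b + (dQ a b ⬝ᵥ P c + Q b ⬝ᵥ dP a c))))
      + (∑ a, ∑ c, Γ a a c * V c b) - (∑ a, ∑ c, Γ c a b * V a c) =
    (1 / 2) * ∑ a, ∑ c, G a c * (φb ⬝ᵥ R a b *ᵥ P c - Q c ⬝ᵥ R a b *ᵥ φ) := by
  have hmass : Q b ⬝ᵥ φ + φb ⬝ᵥ P b = dφb b ⬝ᵥ φ + φb ⬝ᵥ dφ b := by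
    rw [hP, hQ, add_dotProduct, dotProduct_sub, Matrix.dotProduct_mulVec]
    ring
  have htrace : ∑ a, ∑ c, Γ a a c * V c b = L * ∑ a, Γ a a b
      - (1 / 2) * ∑ a, ∑ c, (G a c * ∑ d, Γ d d a) * (Q c ⬝ᵥ P b + Q b ⬝ᵥ P c) := by
    rw [Finset.sum_comm]
    simp only [hV, ← Finset.sum_mul, mul_sub, Finset.sum_sub_distrib]
    congr 1
    · simp [mul_comm]
    · simp only [Finset.mul_sum, Finset.sum_mul]
      refine Finset.sum_congr rfl fun a _ => ?_
      refine Finset.sum_congr rfl fun d _ => Finset.sum_congr rfl fun c _ => ?_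
      ring
  have hmixed : ∑ a, ∑ c, Γ c a b * V a c = L * (∑ a, Γ a a b)
      + (1 / 2) * ∑ a, ∑ c, dG b a c * (Q a ⬝ᵥ P c) := by
    have hsplit : ∀ F : Fin m → Fin m → ℂ, ∑ a, ∑ c, dG b a c * F a c
        = - ∑ a, ∑ c, ∑ d, Γ c a b * (G a d * (F d c + F c d)) := by
      intro F
      have h₁ : ∑ c, ∑ d, ∑ a, Γ c a b * G a d * F c d
          = ∑ a, ∑ c, ∑ d, Γ c a b * (G a d * F c d) := by
        rw [Finset.sum_comm_cycle]
        simp only [mul_assoc]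
      have h₂ : ∑ c, ∑ d, ∑ a, Γ d a b * G a c * F c d
          = ∑ a, ∑ c, ∑ d, Γ c a b * (G a d * F d c) := by
        rw [Finset.sum_comm, Finset.sum_comm_cycle]
        simp only [mul_assoc]
      simp only [hmet, neg_mul, Finset.sum_neg_distrib, Finset.sum_mul, add_mul,
        Finset.sum_add_distrib, h₁, h₂, mul_add]
      ring
    rw [hsplit]
    simp only [hV, mul_sub, Finset.sum_sub_distrib]
    simp only [Finset.mul_sum, mul_neg, ← sub_eq_add_neg]
    congr 1
    · simp [mul_comm]
    · refine Finset.sum_congr rfl fun a _ => Finset.sum_congr rfl fun c _ =>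
        Finset.sum_congr rfl fun d _ => ?_
      ring
  have hcurlP : ∑ a, ∑ c, G a c * (Q a ⬝ᵥ dP b c) = ∑ a, ∑ c, (G a c * (Q c ⬝ᵥ dP a b)
      - G a c * (Q c ⬝ᵥ R a b *ᵥ φ) - G a c * (Q c ⬝ᵥ K a *ᵥ P b)
      + G a c * (Q c ⬝ᵥ K b *ᵥ P a)) := by
    rw [Finset.sum_comm]
    refine Finset.sum_congr rfl fun a _ => Finset.sum_congr rfl fun c _ => ?_
    rw [hG c a, hdP a b]
    simp only [dotProduct_add, dotProduct_sub]
    ring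
  have hcurlQ : ∑ a, ∑ c, G a c * (dQ b a ⬝ᵥ P c) = ∑ a, ∑ c, (G a c * (dQ a b ⬝ᵥ P c)
      + G a c * (φb ⬝ᵥ R a b *ᵥ P c) + G a c * (Q b ⬝ᵥ K a *ᵥ P c)
      - G a c * (Q a ⬝ᵥ K b *ᵥ P c)) := by
    refine Finset.sum_congr rfl fun a _ => Finset.sum_congr rfl fun c _ => ?_
    rw [hdQ a b]
    simp only [add_dotProduct, sub_dotProduct, Matrix.dotProduct_mulVec]
    ring
  have hswap : ∑ a, ∑ c, G a c * (Q a ⬝ᵥ K b *ᵥ P c) = ∑ a, ∑ c, G a c * (Q c ⬝ᵥ K b *ᵥ P a) := by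
    rw [Finset.sum_comm]
    exact Finset.sum_congr rfl fun a _ => Finset.sum_congr rfl fun c _ => by rw [hG c a]
  rw [htrace, hmixed, ← hmass]
  simp only [add_mul, mul_add, mul_sub, Finset.sum_add_distrib, Finset.sum_sub_distrib]
    at hE hEb hcurlP hcurlQ ⊢
  linear_combination (-1 / 2) * hE - (1 / 2) * hEb + (1 / 2) * hcurlP + (1 / 2) * hcurlQ
    - (1 / 2) * hswap

end Algebra

/-- On-shell covariant divergence of the canonical energy-tensor of a charged spin-zero field
coupled to a background gauge field `κ` (`κ x a i j = κ^i_{aj}`) on a metric background `g`: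
assuming the Klein–Gordon field equations, one has
`∇_a Ŭ^a_b = ½ g^{ac} ρ_{ab}{}^i{}_j (φ̄_i ∇_c φ^j − ∇_c φ̄_i φ^j)` on `U`. -/
theorem scalar_field_energy_tensor_on_shell_divergence
    (m n : ℕ) (hm : 1 ≤ m) (hn : 1 ≤ n)
    (U : Set (Fin m → ℝ)) (hU : IsOpen U)
    (g : (Fin m → ℝ) → Matrix (Fin m) (Fin m) ℝ)
    (hgsm : ∀ a b, ContDiffOn ℝ (⊤ : ℕ∞) (fun x => g x a b) U)
    (hgsym : ∀ x ∈ U, (g x).IsSymm)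
    (hginv : ∀ x ∈ U, IsUnit (g x).det)
    (κ : (Fin m → ℝ) → Fin m → Fin n → Fin n → ℂ)
    (hκ : ∀ a i j, ContDiffOn ℝ (⊤ : ℕ∞) (fun x => κ x a i j) U)
    (μ : ℝ)
    (φ φb : (Fin m → ℝ) → Fin n → ℂ)
    (hφ : ∀ i, ContDiffOn ℝ (⊤ : ℕ∞) (fun x => φ x i) U)
    (hφb : ∀ i, ContDiffOn ℝ (⊤ : ℕ∞) (fun x => φb x i) U) :
    -- inverse metric, volume density, Levi-Civita Christoffel symbols `Γ x c a b = Γ^c_{ab}`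
    let gi : (Fin m → ℝ) → Matrix (Fin m) (Fin m) ℝ := fun x => (g x)⁻¹
    let s : (Fin m → ℝ) → ℝ := fun x => Real.sqrt |(g x).det|
    let Γ : (Fin m → ℝ) → Fin m → Fin m → Fin m → ℝ := fun x c a b =>
      (1 / 2) * ∑ d, gi x c d *
        (pd (fun t => g t b d) a x + pd (fun t => g t a d) b x - pd (fun t => g t a b) d x)
    -- covariant derivatives of the field and its conjugate
    let Dφ : (Fin m → ℝ) → Fin m → Fin n → ℂ := fun x a i =>
      pd (fun t => φ t i) a x - ∑ j, κ x a i j * φ x j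
    let Dφb : (Fin m → ℝ) → Fin m → Fin n → ℂ := fun x a i =>
      pd (fun t => φb t i) a x + ∑ j, κ x a j i * φb x j
    -- Lagrangian density, canonical energy-tensor, and its scalarized version
    let ℓ : (Fin m → ℝ) → ℂ := fun x => (1 / 2) *
      ((∑ a, ∑ b, ∑ i, (gi x a b : ℂ) * Dφb x a i * Dφ x b i)
        - (μ : ℂ) ^ 2 * ∑ i, φb x i * φ x i) * (s x : ℂ)
    let Ut : (Fin m → ℝ) → Fin m → Fin m → ℂ := fun x a b =>
      ℓ x * (if a = b then 1 else 0)
        - (1 / 2) * (∑ c, ∑ i, (gi x a c : ℂ) * (Dφb x c i * Dφ x b i + Dφb x b i * Dφ x c i))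
          * (s x : ℂ)
    let Ub : (Fin m → ℝ) → Fin m → Fin m → ℂ := fun x a b => Ut x a b / (s x : ℂ)
    -- curvature of the gauge field
    let ρ : (Fin m → ℝ) → Fin m → Fin m → Fin n → Fin n → ℂ := fun x a b i j =>
      pd (fun t => κ t a i j) b x - pd (fun t => κ t b i j) a x
        + (∑ h, κ x a i h * κ x b h j) - ∑ h, κ x b i h * κ x a h j
    -- field equation for `φ`
    (∀ x ∈ U, ∀ i : Fin n,
      (∑ a, pd (fun t => ∑ b, (gi t a b : ℂ) * (s t : ℂ) * Dφ t b i) a x)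
        - (∑ a, ∑ b, (gi x a b : ℂ) * (s x : ℂ) * ∑ j, κ x a i j * Dφ x b j)
        + (μ : ℂ) ^ 2 * (s x : ℂ) * φ x i = 0) →
    -- field equation for `φ̄`
    (∀ x ∈ U, ∀ i : Fin n,
      (∑ a, pd (fun t => ∑ b, (gi t a b : ℂ) * (s t : ℂ) * Dφb t b i) a x)
        + (∑ a, ∑ b, (gi x a b : ℂ) * (s x : ℂ) * ∑ j, κ x a j i * Dφb x b j)
        + (μ : ℂ) ^ 2 * (s x : ℂ) * φb x i = 0) →
    -- conclusion: on-shell covariant divergence of `Ŭ`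
    ∀ x ∈ U, ∀ b : Fin m,
      (∑ a, pd (fun t => Ub t a b) a x)
        + (∑ a, ∑ c, (Γ x a a c : ℂ) * Ub x c b)
        - (∑ a, ∑ c, (Γ x c a b : ℂ) * Ub x a c) =
      (1 / 2) * ∑ a, ∑ c, ∑ i, ∑ j,
        (gi x a c : ℂ) * ρ x a b i j * (φb x i * Dφ x c j - Dφb x c i * φ x j) := by
  intro gi s Γ Dφ Dφb ℓ Ut Ub ρ hE hEb x hx b
  have hUx : U ∈ nhds x := hU.mem_nhds hx
  have hdet : ∀ t ∈ U, (g t).det ≠ 0 := fun t ht => (hginv t ht).ne_zero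
  have hs : ∀ t ∈ U, (s t : ℂ) ≠ 0 := fun t ht =>
    Complex.ofReal_ne_zero.2 (Real.sqrt_pos.2 (abs_pos.2 (hdet t ht))).ne'
  have hg : ∀ a c, DifferentiableAt ℝ (fun t => g t a c) x := fun a c =>
    ((hgsm a c).contDiffAt hUx).differentiableAt (by simp)
  have hκd : ∀ a i j, DifferentiableAt ℝ (fun t => κ t a i j) x := fun a i j =>
    ((hκ a i j).contDiffAt hUx).differentiableAt (by simp)
  have hφc : ∀ i, ContDiffAt ℝ (⊤ : ℕ∞) (fun t => φ t i) x := fun i => (hφ i).contDiffAt hUx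
  have hφbc : ∀ i, ContDiffAt ℝ (⊤ : ℕ∞) (fun t => φb t i) x := fun i => (hφb i).contDiffAt hUx
  have hφd : ∀ i, DifferentiableAt ℝ (fun t => φ t i) x := fun i =>
    (hφc i).differentiableAt (by simp)
  have hφbd : ∀ i, DifferentiableAt ℝ (fun t => φb t i) x := fun i =>
    (hφbc i).differentiableAt (by simp)
  have hgid : ∀ a c, DifferentiableAt ℝ (fun t => (gi t a c : ℂ)) x := fun a c =>
    differentiableAt_ofReal (differentiableAt_inv_apply hg (hdet x hx) a c)
  have hsd : DifferentiableAt ℝ (fun t => (s t : ℂ)) x :=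
    differentiableAt_ofReal (pd_sqrt_abs_det hg (hdet x hx) b).1
  have hDφ : ∀ a i, DifferentiableAt ℝ (fun t => Dφ t a i) x := fun a i =>
    (differentiableAt_pd (hφc i) a).fun_sub
      (DifferentiableAt.fun_sum fun j _ => (hκd a i j).fun_mul (hφd j))
  have hDφb : ∀ a i, DifferentiableAt ℝ (fun t => Dφb t a i) x := fun a i =>
    (differentiableAt_pd (hφbc i) a).fun_add
      (DifferentiableAt.fun_sum fun j _ => (hκd a j i).fun_mul (hφbd j))
  have hgisym : ∀ a c, gi x a c = gi x c a := fun a c => (hgsym x hx).inv.apply c a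
  have hHsym : ∀ a c d, pd (fun t => g t c d) a x = pd (fun t => g t d c) a x := by
    intro a c d
    refine pd_congr ?_ a
    filter_upwards [hUx] with t ht
    exact (hgsym t ht).apply d c
  -- derivatives of the volume density and of the inverse metric
  have hds : ∀ a, pd (fun t => (s t : ℂ)) a x = s x * ∑ d, (Γ x d d a : ℂ) := by
    intro a
    obtain ⟨h, h'⟩ := pd_sqrt_abs_det hg (hdet x hx) a
    rw [pd_ofReal h, h', ← sum_christoffel_diag hgisym hHsym a]
    push_cast [Γ, s]
    rfl
  have hmet : ∀ e c d, pd (fun t => (gi t c d : ℂ)) e x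
      = - ∑ a, ((Γ x c a e : ℂ) * (gi x a d : ℂ) + (Γ x d a e : ℂ) * (gi x a c : ℂ)) := by
    intro e c d
    rw [pd_ofReal (differentiableAt_inv_apply hg (hdet x hx) c d),
      pd_inv_apply hg (Filter.mem_of_superset hUx hdet) e c d,
      ← christoffel_metric_compatible hgisym hHsym e c d]
    push_cast [Γ, s]
    rfl
  -- derivatives of the covariant derivatives
  have hdDφ : ∀ a c i, pd (fun t => Dφ t a i) c x = pd (fun t => pd (fun t => φ t i) a t) c x
      - ((∑ j, pd (fun t => κ t a i j) c x * φ x j)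
        + ∑ j, κ x a i j * pd (fun t => φ t j) c x) := by
    intro a c i
    rw [← Finset.sum_add_distrib, pd_sub (differentiableAt_pd (hφc i) a)
      (DifferentiableAt.fun_sum fun j _ => (hκd a i j).fun_mul (hφd j)),
      pd_sum fun j _ => (hκd a i j).fun_mul (hφd j)]
    simp only [pd_mul (hκd a i _) (hφd _)]
  have hdDφb : ∀ a c i, pd (fun t => Dφb t a i) c x = pd (fun t => pd (fun t => φb t i) a t) c x
      + ((∑ j, φb x j * pd (fun t => κ t a j i) c x)
        + ∑ j, pd (fun t => φb t j) c x * κ x a j i) := by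
    intro a c i
    rw [← Finset.sum_add_distrib, pd_add (differentiableAt_pd (hφbc i) a)
      (DifferentiableAt.fun_sum fun j _ => (hκd a j i).fun_mul (hφbd j)),
      pd_sum fun j _ => (hκd a j i).fun_mul (hφbd j)]
    simp only [pd_mul (hκd a _ i) (hφbd _), mul_comm]
  let K : Fin m → Matrix (Fin n) (Fin n) ℂ := fun a => Matrix.of fun i j => κ x a i j
  let dK : Fin m → Fin m → Matrix (Fin n) (Fin n) ℂ := fun c a =>
    Matrix.of fun i j => pd (fun t => κ t a i j) c x
  let dφ : Fin m → Fin n → ℂ := fun a i => pd (fun t => φ t i) a x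
  let dφb : Fin m → Fin n → ℂ := fun a i => pd (fun t => φb t i) a x
  let dP : Fin m → Fin m → Fin n → ℂ := fun c a i => pd (fun t => Dφ t a i) c x
  let dQ : Fin m → Fin m → Fin n → ℂ := fun c a i => pd (fun t => Dφb t a i) c x
  have hP : ∀ a, Dφ x a = dφ a - K a *ᵥ φ x := fun a => rfl
  have hQ : ∀ a, Dφb x a = dφb a + φb x ᵥ* K a := by
    intro a
    ext i
    simp [Dφb, dφb, K, Matrix.vecMul, dotProduct, mul_comm]
  have hdP := curl_covariantDeriv (K := K) (dK := dK) (dP := dP)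
    (ddφ := fun c a i => pd (fun t => pd (fun t => φ t i) a t) c x)
    (fun a c => funext fun i => pd_comm (hφc i) c a) hP
    (fun a c => funext fun i => hdDφ a c i)
  have hdQ := curl_covariantDeriv_conj (K := K) (dK := dK) (dQ := dQ)
    (ddφb := fun c a i => pd (fun t => pd (fun t => φb t i) a t) c x)
    (fun a c => funext fun i => pd_comm (hφbc i) c a) hQ
    (fun a c => funext fun i => hdDφb a c i)
  -- the field equations, divided by the volume density
  have hEx : (∑ a, ∑ c, ((pd (fun t => (gi t a c : ℂ)) a x
        + (gi x a c : ℂ) * ∑ d, (Γ x d d a : ℂ)) • Dφ x c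
      + (gi x a c : ℂ) • dP a c - (gi x a c : ℂ) • K a *ᵥ Dφ x c)) + (μ : ℂ) ^ 2 • φ x = 0 := by
    ext i
    refine mul_left_cancel₀ (hs x hx) ?_
    rw [Pi.zero_apply, mul_zero, ← hE x hx i, ← Finset.sum_sub_distrib]
    simp only [Pi.add_apply, Pi.sub_apply, Pi.smul_apply, Finset.sum_apply, smul_eq_mul]
    rw [mul_add, Finset.mul_sum]
    refine congrArg₂ (· + ·) (Finset.sum_congr rfl fun a _ => ?_) (by ring)
    rw [Finset.mul_sum, pd_sum fun c _ => ((hgid a c).fun_mul hsd).fun_mul (hDφ c i),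
      ← Finset.sum_sub_distrib]
    refine Finset.sum_congr rfl fun c _ => ?_
    rw [pd_mul ((hgid a c).fun_mul hsd) (hDφ c i), pd_mul (hgid a c) hsd, hds]
    change _ * (_ + _ * pd (fun t => Dφ t c i) a x - _ * ∑ j, κ x a i j * Dφ x c j) = _
    ring
  have hEbx : (∑ a, ∑ c, ((pd (fun t => (gi t a c : ℂ)) a x
        + (gi x a c : ℂ) * ∑ d, (Γ x d d a : ℂ)) • Dφb x c
      + (gi x a c : ℂ) • dQ a c + (gi x a c : ℂ) • Dφb x c ᵥ* K a)) + (μ : ℂ) ^ 2 • φb x = 0 := by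
    ext i
    refine mul_left_cancel₀ (hs x hx) ?_
    rw [Pi.zero_apply, mul_zero, ← hEb x hx i, ← Finset.sum_add_distrib]
    simp only [Pi.add_apply, Pi.smul_apply, Finset.sum_apply, smul_eq_mul]
    rw [mul_add, Finset.mul_sum]
    refine congrArg₂ (· + ·) (Finset.sum_congr rfl fun a _ => ?_) (by ring)
    rw [Finset.mul_sum, pd_sum fun c _ => ((hgid a c).fun_mul hsd).fun_mul (hDφb c i),
      ← Finset.sum_add_distrib]
    refine Finset.sum_congr rfl fun c _ => ?_
    have hK : (Dφb x c ᵥ* K a) i = ∑ j, κ x a j i * Dφb x c j := by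
      simp [K, Matrix.vecMul, dotProduct, mul_comm]
    rw [pd_mul ((hgid a c).fun_mul hsd) (hDφb c i), pd_mul (hgid a c) hsd, hds, hK]
    change _ * (_ + _ * pd (fun t => Dφb t c i) a x + _) = _
    ring
  -- the energy tensor and its derivative
  have hUb : ∀ t ∈ U, ∀ a c, Ub t a c
      = ((1 / 2) * ((∑ a, ∑ c, (gi t a c : ℂ) * (Dφb t a ⬝ᵥ Dφ t c))
          - (μ : ℂ) ^ 2 * (φb t ⬝ᵥ φ t))) * (if a = c then 1 else 0)
        - (1 / 2) * ∑ d, (gi t a d : ℂ) * (Dφb t d ⬝ᵥ Dφ t c + Dφb t c ⬝ᵥ Dφ t d) := by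
    intro t ht a c
    have hst := hs t ht
    simp only [Ub, Ut, ℓ, dotProduct, ← Finset.mul_sum, mul_assoc, ← Finset.sum_add_distrib]
    field_simp
  have hF : ∀ c d, DifferentiableAt ℝ (fun t => Dφb t c ⬝ᵥ Dφ t d) x := fun c d =>
    DifferentiableAt.fun_sum fun i _ => (hDφb c i).fun_mul (hDφ d i)
  have hdF : ∀ c d e, pd (fun t => Dφb t c ⬝ᵥ Dφ t d) e x
      = dQ e c ⬝ᵥ Dφ x d + Dφb x c ⬝ᵥ dP e d := by
    intro c d e
    refine (pd_sum (fun i _ => (hDφb c i).fun_mul (hDφ d i)) e).trans ?_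
    simp only [pd_mul (hDφb c _) (hDφ d _), Finset.sum_add_distrib]
    rfl
  have hN : DifferentiableAt ℝ (fun t => φb t ⬝ᵥ φ t) x :=
    DifferentiableAt.fun_sum fun i _ => (hφbd i).fun_mul (hφd i)
  have hdN : ∀ e, pd (fun t => φb t ⬝ᵥ φ t) e x = dφb e ⬝ᵥ φ x + φb x ⬝ᵥ dφ e := by
    intro e
    refine (pd_sum (fun i _ => (hφbd i).fun_mul (hφd i)) e).trans ?_
    simp only [pd_mul (hφbd _) (hφd _), Finset.sum_add_distrib]
    rfl
  have hGF : ∀ a c, DifferentiableAt ℝ (fun t => (gi t a c : ℂ) * (Dφb t a ⬝ᵥ Dφ t c)) x :=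
    fun a c => (hgid a c).fun_mul (hF a c)
  have hGFs : ∀ a, DifferentiableAt ℝ
      (fun t => ∑ c, (gi t a c : ℂ) * (Dφb t a ⬝ᵥ Dφ t c)) x :=
    fun a => DifferentiableAt.fun_sum fun c _ => hGF a c
  have hL₀ : DifferentiableAt ℝ (fun t => (∑ a, ∑ c, (gi t a c : ℂ) * (Dφb t a ⬝ᵥ Dφ t c))
      - (μ : ℂ) ^ 2 * (φb t ⬝ᵥ φ t)) x :=
    (DifferentiableAt.fun_sum fun a _ => hGFs a).fun_sub (hN.const_mul _)
  have hT : ∀ a d, DifferentiableAt ℝ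
      (fun t => (gi t a d : ℂ) * (Dφb t d ⬝ᵥ Dφ t b + Dφb t b ⬝ᵥ Dφ t d)) x :=
    fun a d => (hgid a d).fun_mul ((hF d b).fun_add (hF b d))
  have hTs : ∀ a, DifferentiableAt ℝ
      (fun t => ∑ d, (gi t a d : ℂ) * (Dφb t d ⬝ᵥ Dφ t b + Dφb t b ⬝ᵥ Dφ t d)) x :=
    fun a => DifferentiableAt.fun_sum fun d _ => hT a d
  have hdiv : ∑ a, pd (fun t => Ub t a b) a x
      = (1 / 2) * ((∑ a, ∑ c, (pd (fun t => (gi t a c : ℂ)) b x * (Dφb x a ⬝ᵥ Dφ x c)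
          + (gi x a c : ℂ) * (dQ b a ⬝ᵥ Dφ x c + Dφb x a ⬝ᵥ dP b c)))
        - (μ : ℂ) ^ 2 * (dφb b ⬝ᵥ φ x + φb x ⬝ᵥ dφ b))
      - (1 / 2) * ∑ a, ∑ c, (pd (fun t => (gi t a c : ℂ)) a x
          * (Dφb x c ⬝ᵥ Dφ x b + Dφb x b ⬝ᵥ Dφ x c)
        + (gi x a c : ℂ) * (dQ a c ⬝ᵥ Dφ x b + Dφb x c ⬝ᵥ dP a b
          + (dQ a b ⬝ᵥ Dφ x c + Dφb x b ⬝ᵥ dP a c))) := by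
    have hdL : pd (fun t => (1 / 2) * ((∑ a, ∑ c, (gi t a c : ℂ) * (Dφb t a ⬝ᵥ Dφ t c))
        - (μ : ℂ) ^ 2 * (φb t ⬝ᵥ φ t))) b x
        = (1 / 2) * ((∑ a, ∑ c, (pd (fun t => (gi t a c : ℂ)) b x * (Dφb x a ⬝ᵥ Dφ x c)
          + (gi x a c : ℂ) * (dQ b a ⬝ᵥ Dφ x c + Dφb x a ⬝ᵥ dP b c)))
        - (μ : ℂ) ^ 2 * (dφb b ⬝ᵥ φ x + φb x ⬝ᵥ dφ b)) := by
      rw [pd_const_mul _ hL₀, pd_sub (DifferentiableAt.fun_sum fun a _ => hGFs a)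
        (hN.const_mul _), pd_const_mul _ hN, hdN, pd_sum fun a _ => hGFs a]
      simp only [pd_sum fun c _ => hGF _ c, pd_mul (hgid _ _) (hF _ _), hdF]
    have hterm : ∀ a, pd (fun t => Ub t a b) a x
        = (if a = b then pd (fun t => (1 / 2) * ((∑ a, ∑ c, (gi t a c : ℂ)
            * (Dφb t a ⬝ᵥ Dφ t c)) - (μ : ℂ) ^ 2 * (φb t ⬝ᵥ φ t))) a x else 0)
          - (1 / 2) * ∑ c, (pd (fun t => (gi t a c : ℂ)) a x
            * (Dφb x c ⬝ᵥ Dφ x b + Dφb x b ⬝ᵥ Dφ x c)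
          + (gi x a c : ℂ) * (dQ a c ⬝ᵥ Dφ x b + Dφb x c ⬝ᵥ dP a b
            + (dQ a b ⬝ᵥ Dφ x c + Dφb x b ⬝ᵥ dP a c))) := by
      intro a
      rw [pd_congr (Filter.mem_of_superset hUx fun t ht => hUb t ht a b) a,
        pd_sub ((hL₀.const_mul _).mul_const _) ((hTs a).const_mul _), pd_const_mul _ (hTs a),
        pd_sum fun d _ => hT a d]
      simp only [pd_mul (hgid a _) ((hF _ b).fun_add (hF b _)), pd_add (hF _ b) (hF b _), hdF]
      congr 1
      split_ifs with h
      · simp only [mul_one]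
      · simp only [mul_zero, pd_const]
    simp only [hterm, Finset.sum_sub_distrib, Finset.sum_ite_eq', Finset.mem_univ, if_true, hdL,
      ← Finset.mul_sum]
  have hR : ∀ a c, ∑ i, ∑ j, (gi x a c : ℂ) * ρ x a b i j
        * (φb x i * Dφ x c j - Dφb x c i * φ x j)
      = (gi x a c : ℂ) * (φb x ⬝ᵥ (dK b a - dK a b + K a * K b - K b * K a) *ᵥ Dφ x c
        - Dφb x c ⬝ᵥ (dK b a - dK a b + K a * K b - K b * K a) *ᵥ φ x) := by
    intro a c
    have hρ : ∀ i j, (dK b a - dK a b + K a * K b - K b * K a) i j = ρ x a b i j := by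
      intro i j
      simp [dK, K, ρ, Matrix.mul_apply]
    simp only [dotProduct, Matrix.mulVec, hρ, Finset.mul_sum, ← Finset.sum_sub_distrib]
    refine Finset.sum_congr rfl fun i _ => Finset.sum_congr rfl fun j _ => ?_
    ring
  simp only [hR]
  rw [hdiv]
  refine divergence_identity (G := fun a c => (gi x a c : ℂ))
    (dG := fun e a c => pd (fun t => (gi t a c : ℂ)) e x) (Γ := fun c a e => (Γ x c a e : ℂ))
    (V := Ub x) (fun a c => by rw [hgisym a c]) hmet hP hQ hdP hdQ b ?_ ?_ (hUb x hx)
  · have h := congrArg (Dφb x b ⬝ᵥ ·) hEx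
    simpa only [dotProduct_add, dotProduct_sub, dotProduct_sum, dotProduct_smul, smul_eq_mul,
      dotProduct_zero] using h
  · have h := congrArg (· ⬝ᵥ Dφ x b) hEbx
    simpa only [add_dotProduct, sum_dotProduct, smul_dotProduct, smul_eq_mul,
      zero_dotProduct, Matrix.dotProduct_mulVec] using h
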